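/- arXiv:1906.06692 — 2 statements merged into one kernel-verified Lean document; each statement's English description precedes it below -/
import Mathlib

section
/- Let A be an associative algebra over a field k of prime characteristic p, with elements g, x satisfying g^n = 1 (p | n) and g*x - x*g = g*(1-g). Then (ad_L x)^{p-1}(g) = g - g^p and x^p * g - g * x^p = x*g - g*x. -/
open Polynomial in
theorem aux_prod (p : ℕ) [Fact p.Prime] :
    ∏ i ∈ Finset.range (p - 1), (X + C ((i + 1 : ℕ) : ZMod p)) = X ^ (p - 1) - 1 := by
  have hp : p.Prime := Fact.out
  have h2 := hp.two_le
  have hm : (∏ i ∈ Finset.range (p - 1), (X + C ((i + 1 : ℕ) : ZMod p))).Monic :=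
    monic_prod_of_monic _ _ fun i _ => monic_X_add_C _
  have hd : (∏ i ∈ Finset.range (p - 1), (X + C ((i + 1 : ℕ) : ZMod p))).degree
      = ((p - 1 : ℕ) : WithBot ℕ) := by
    rw [degree_prod]
    simp only [degree_X_add_C]
    simp
  have hm' : (X ^ (p - 1) - 1 : (ZMod p)[X]).Monic := by
    rw [← C_1]; exact monic_X_pow_sub_C _ (by omega)
  have hd' : (X ^ (p - 1) - 1 : (ZMod p)[X]).degree = ((p - 1 : ℕ) : WithBot ℕ) := by
    rw [← C_1]; exact degree_X_pow_sub_C (by omega) _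
  refine eq_of_degree_sub_lt_of_eval_finset_eq ((Finset.univ : Finset (ZMod p)).erase 0) ?_ ?_
  · rw [Finset.card_erase_of_mem (Finset.mem_univ _), Finset.card_univ, ZMod.card, ← hd]
    exact degree_sub_lt_left (hd.trans hd'.symm) hm.ne_zero (hm.leadingCoeff.trans hm'.leadingCoeff.symm)
  · intro a ha
    have ha0 : a ≠ 0 := Finset.ne_of_mem_erase ha
    have : eval a (X ^ (p - 1) - 1 : (ZMod p)[X]) = 0 := by
      simp [ZMod.pow_card_sub_one_eq_one ha0]
    rw [this, eval_prod]
    have hv : (-a).val ≠ 0 := by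
      rw [Ne, ZMod.val_eq_zero]; simpa using ha0
    have hlt := ZMod.val_lt (-a)
    refine Finset.prod_eq_zero (i := (-a).val - 1) (Finset.mem_range.2 (by omega)) ?_
    rw [Nat.sub_add_cancel (by omega)]
    simp

theorem aux_pow {A : Type*} [Ring A] (g x : A) (hgx : g * x - x * g = g * (1 - g)) (i : ℕ) :
    x * g ^ i - g ^ i * x = i * (g ^ (i + 1) - g ^ i) := by
  induction i with
  | zero => simp
  | succ i ih =>
    have h1 : x * g = g * x - g + g * g := by
      have := hgx
      rw [mul_sub, mul_one] at this
      rw [eq_comm, sub_add, ← this]; abel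
    have h2 : x * g ^ i = g ^ i * x + i * (g ^ (i + 1) - g ^ i) := by rw [← ih]; abel
    have : x * g ^ (i + 1) = g ^ (i + 1) * x + ((i + 1 : ℕ) : A) * (g ^ (i + 1 + 1) - g ^ (i + 1)) := by
      rw [pow_succ g i, ← mul_assoc, h2, add_mul, mul_assoc _ x g, h1]
      push_cast
      simp only [pow_succ]
      noncomm_ring
    rw [this]; abel

theorem adL_on_g (k : Type*) [Field k] (p n : ℕ) (hp : p.Prime) [CharP k p]
    (hpn : p ∣ n)
    (A : Type*) [Ring A] [Algebra k A] (g x : A)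
    (hg : g ^ n = 1) (hgx : g * x - x * g = g * (1 - g)) :
    (fun a => x * a - a * x)^[p - 1] g = g - g ^ p ∧
      x ^ p * g - g * x ^ p = x * g - g * x := by
  rcases subsingleton_or_nontrivial A with hA | hA
  · exact ⟨Subsingleton.elim _ _, Subsingleton.elim _ _⟩
  have : Fact p.Prime := ⟨hp⟩
  have : CharP A p := charP_of_injective_algebraMap (algebraMap k A).injective p
  let : Algebra (ZMod p) A := ZMod.algebra A p
  have : CharP (Module.End (ZMod p) A) p :=
    charP_of_injective_algebraMap (algebraMap (ZMod p) (Module.End (ZMod p) A)).injective p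
  set D : Module.End (ZMod p) A := LinearMap.mulLeft (ZMod p) x - LinearMap.mulRight (ZMod p) x
    with hD
  have hDa : ∀ a, D a = x * a - a * x := fun a => rfl
  have hit : ∀ m, (fun a => x * a - a * x)^[m] g = (D ^ m) g := by
    intro m
    rw [Module.End.pow_apply]; rfl
  have hprod : ∀ m : ℕ, (Polynomial.aeval D
      (∏ i ∈ Finset.range m, (Polynomial.X + Polynomial.C ((i + 1 : ℕ) : ZMod p)))) g
      = (m.factorial : A) * g ^ (m + 1) := by
    intro m
    induction m with
    | zero => simp
    | succ m ih =>
      rw [Finset.prod_range_succ, mul_comm, map_mul, Module.End.mul_apply, ih]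
      have hc : (Polynomial.aeval D)
          (Polynomial.X + Polynomial.C ((m + 1 : ℕ) : ZMod p)) = D + ((m + 1 : ℕ) : Module.End (ZMod p) A) := by
        simp
      rw [hc, ← nsmul_eq_mul, map_nsmul, LinearMap.add_apply, hDa, aux_pow g x hgx,
        Module.End.natCast_apply, Nat.factorial_succ, nsmul_eq_mul, nsmul_eq_mul, mul_sub,
        sub_add_cancel, ← mul_assoc, Nat.mul_comm, Nat.cast_mul]
  have h1 : (D ^ (p - 1)) g = g - g ^ p := by
    have := hprod (p - 1)
    have hw : (((p - 1).factorial : ℕ) : A) = -1 := by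
      have := congrArg (algebraMap (ZMod p) A) (ZMod.wilsons_lemma p)
      rwa [map_natCast, map_neg, map_one] at this
    rw [aux_prod, hw, Nat.sub_add_cancel hp.one_le] at this
    simp at this
    rw [sub_eq_iff_eq_add] at this
    rw [this]; abel
  refine ⟨by rw [hit, h1], ?_⟩
  have h2 : (D ^ p) g = x ^ p * g - g * x ^ p := by
    rw [hD, sub_pow_char_of_commute p (LinearMap.commute_mulLeft_right x x),
      LinearMap.pow_mulLeft, LinearMap.pow_mulRight]
    rfl
  have h3 : D ^ p = D * D ^ (p - 1) := by
    rw [← pow_succ']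
    exact congrArg (fun m => D ^ m) (Nat.sub_add_cancel hp.one_le).symm
  rw [← h2, h3, Module.End.mul_apply, h1, map_sub,
    hDa, hDa, aux_pow g x hgx]
  simp
end

section
/- Let C and D be coalgebras over a field k with C pointed, and let f : C → D be a coalgebra map. Then f is injective if and only if the restriction of f to the first term C₁ of the coradical filtration of C is injective. -/
open TensorProduct

variable (k : Type*) [Field k]

/-- A submodule of a coalgebra is a subcoalgebra if the comultiplication of each of its
elements lies in the image of `V ⊗ V` in `C ⊗ C`. -/
def IsSubcoalgebra {C : Type*} [AddCommGroup C] [Module k C] [Coalgebra k C]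
    (V : Submodule k C) : Prop :=
  ∀ v ∈ V, Coalgebra.comul (R := k) v ∈
    LinearMap.range (TensorProduct.map V.subtype V.subtype)

/-- A simple subcoalgebra: a nonzero subcoalgebra whose only subcoalgebras are `⊥` and
itself. -/
def IsSimpleSubcoalgebra {C : Type*} [AddCommGroup C] [Module k C] [Coalgebra k C]
    (V : Submodule k C) : Prop :=
  V ≠ ⊥ ∧ IsSubcoalgebra k V ∧
    ∀ W : Submodule k C, IsSubcoalgebra k W → W ≤ V → W = ⊥ ∨ W = V

/-- A coalgebra is pointed if every simple subcoalgebra is one-dimensional. -/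
def IsPointedCoalgebra (C : Type*) [AddCommGroup C] [Module k C] [Coalgebra k C] : Prop :=
  ∀ V : Submodule k C, IsSimpleSubcoalgebra k V → Module.finrank k V = 1

/-- The coradical `C₀`: the sum of all simple subcoalgebras. -/
def coradical (C : Type*) [AddCommGroup C] [Module k C] [Coalgebra k C] : Submodule k C :=
  sSup {V : Submodule k C | IsSimpleSubcoalgebra k V}

/-- The first term `C₁ = Δ⁻¹(C ⊗ C₀ + C₀ ⊗ C)` of the coradical filtration. -/
def coradicalOne (C : Type*) [AddCommGroup C] [Module k C] [Coalgebra k C] :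
    Submodule k C :=
  Submodule.comap (Coalgebra.comul (R := k))
    (LinearMap.range (TensorProduct.map LinearMap.id (coradical k C).subtype) ⊔
      LinearMap.range (TensorProduct.map (coradical k C).subtype LinearMap.id))

section Helpers

variable {k : Type*} [Field k]

/-- Contract the right factor with a functional. -/
noncomputable def sliceR {M N : Type*} [AddCommGroup M] [Module k M] [AddCommGroup N] [Module k N]
    (φ : N →ₗ[k] k) : M ⊗[k] N →ₗ[k] M :=
  (TensorProduct.rid k M).toLinearMap ∘ₗ LinearMap.lTensor M φ

/-- Contract the left factor with a functional. -/
noncomputable def sliceL {M N : Type*} [AddCommGroup M] [Module k M] [AddCommGroup N] [Module k N]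
    (φ : M →ₗ[k] k) : M ⊗[k] N →ₗ[k] N :=
  (TensorProduct.lid k N).toLinearMap ∘ₗ LinearMap.rTensor N φ

section slices
variable {M N : Type*} [AddCommGroup M] [Module k M] [AddCommGroup N] [Module k N]

@[simp] lemma sliceR_tmul (φ : N →ₗ[k] k) (m : M) (n : N) :
    sliceR φ (m ⊗ₜ[k] n) = φ n • m := by simp [sliceR]

@[simp] lemma sliceL_tmul (φ : M →ₗ[k] k) (m : M) (n : N) :
    sliceL φ (m ⊗ₜ[k] n) = φ m • n := by simp [sliceL]

lemma sliceR_separates (t : M ⊗[k] N) (h : ∀ φ : N →ₗ[k] k, sliceR φ t = 0) : t = 0 := by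
  classical
  let b := Module.Basis.ofVectorSpace k N
  apply (TensorProduct.equivFinsuppOfBasisRight (M := M) b).injective
  rw [map_zero]
  ext i
  have key : ∀ t : M ⊗[k] N, TensorProduct.equivFinsuppOfBasisRight (M := M) b t i
      = sliceR (b.coord i) t := by
    intro t
    induction t with
    | zero => simp
    | tmul x y => simp
    | add x y hx hy => simp [hx, hy]
  rw [key, h]; rfl

lemma sliceL_separates (t : M ⊗[k] N) (h : ∀ φ : M →ₗ[k] k, sliceL φ t = 0) : t = 0 := by
  apply (TensorProduct.comm k M N).injective
  rw [map_zero]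
  apply sliceR_separates
  intro φ
  rw [← h φ]
  have : (sliceR φ ∘ₗ (TensorProduct.comm k M N).toLinearMap) = sliceL φ := by
    ext; simp
  exact LinearMap.congr_fun this t

lemma slice_separates (t : M ⊗[k] N)
    (h : ∀ (φ : M →ₗ[k] k) (ψ : N →ₗ[k] k), φ (sliceR ψ t) = 0) : t = 0 :=
  sliceR_separates t fun ψ => (Module.forall_dual_apply_eq_zero_iff k _).1 fun φ => h φ ψ

lemma slice_comm (t : M ⊗[k] N) (φ : M →ₗ[k] k) (ψ : N →ₗ[k] k) :
    φ (sliceR ψ t) = ψ (sliceL φ t) := by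
  induction t with
  | zero => simp
  | tmul x y => simp [mul_comm]
  | add x y hx hy => simp [hx, hy]

lemma sliceR_map {M' N' : Type*} [AddCommGroup M'] [Module k M'] [AddCommGroup N'] [Module k N']
    (f : M →ₗ[k] M') (g : N →ₗ[k] N') (φ : N' →ₗ[k] k) (t : M ⊗[k] N) :
    sliceR φ (TensorProduct.map f g t) = f (sliceR (φ ∘ₗ g) t) := by
  induction t with
  | zero => simp
  | tmul x y => simp
  | add x y hx hy => simp [hx, hy]

lemma sliceL_map {M' N' : Type*} [AddCommGroup M'] [Module k M'] [AddCommGroup N'] [Module k N']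
    (f : M →ₗ[k] M') (g : N →ₗ[k] N') (φ : M' →ₗ[k] k) (t : M ⊗[k] N) :
    sliceL φ (TensorProduct.map f g t) = g (sliceL (φ ∘ₗ f) t) := by
  induction t with
  | zero => simp
  | tmul x y => simp
  | add x y hx hy => simp [hx, hy]

end slices

variable {C : Type*} [AddCommGroup C] [Module k C] [Coalgebra k C]

/-- `x ↦ x₁ φ(x₂)`. -/
noncomputable def lam (φ : C →ₗ[k] k) : C →ₗ[k] C := sliceR φ ∘ₗ Coalgebra.comul

/-- `x ↦ φ(x₁) x₂`. -/
noncomputable def rho (φ : C →ₗ[k] k) : C →ₗ[k] C := sliceL φ ∘ₗ Coalgebra.comul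

lemma lam_apply (φ : C →ₗ[k] k) (x : C) : lam φ x = sliceR φ (Coalgebra.comul x) := rfl
lemma rho_apply (φ : C →ₗ[k] k) (x : C) : rho φ x = sliceL φ (Coalgebra.comul x) := rfl

lemma dual_lam (φ ψ : C →ₗ[k] k) (x : C) : φ (lam ψ x) = ψ (rho φ x) := slice_comm _ _ _

lemma lam_add (φ ψ : C →ₗ[k] k) : lam (φ + ψ) = lam φ + lam ψ := by
  simp [lam, sliceR, LinearMap.lTensor_add, LinearMap.comp_add, LinearMap.add_comp]

lemma lam_smul (c : k) (ψ : C →ₗ[k] k) : lam (c • ψ) = c • lam ψ := by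
  simp [lam, sliceR, LinearMap.lTensor_smul, LinearMap.comp_smul, LinearMap.smul_comp]

lemma lam_counit : lam (Coalgebra.counit (R := k) (A := C)) = LinearMap.id := by
  ext x; simp [lam, sliceR]

lemma rho_counit : rho (Coalgebra.counit (R := k) (A := C)) = LinearMap.id := by
  ext x; simp [rho, sliceL]

lemma counit_lam (φ : C →ₗ[k] k) (x : C) : Coalgebra.counit (R := k) (lam φ x) = φ x := by
  rw [dual_lam, rho_counit]; rfl

lemma counit_rho (φ : C →ₗ[k] k) (x : C) : Coalgebra.counit (R := k) (rho φ x) = φ x := by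
  rw [← dual_lam, lam_counit]; rfl

lemma rho_lam (φ ψ : C →ₗ[k] k) (x : C) : rho φ (lam ψ x) = lam ψ (rho φ x) := by
  have h := Coalgebra.coassoc_apply (R := k) x
  have e1 : ∀ t : C ⊗[k] C, rho φ (sliceR ψ t) =
      sliceL φ (sliceR ψ (Coalgebra.comul.rTensor C t)) := by
    intro t
    induction t with
    | zero => simp
    | tmul x y => simp [rho_apply]
    | add x y hx hy => simp [hx, hy]
  have e2 : ∀ t : C ⊗[k] C, lam ψ (sliceL φ t) =
      sliceR ψ (sliceL φ (Coalgebra.comul.lTensor C t)) := by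
    intro t
    induction t with
    | zero => simp
    | tmul x y => simp [lam_apply]
    | add x y hx hy => simp [hx, hy]
  have e3 : ∀ t : (C ⊗[k] C) ⊗[k] C, sliceL φ (sliceR ψ t) =
      sliceR ψ (sliceL φ (TensorProduct.assoc k C C C t)) := by
    intro t
    induction t with
    | zero => simp
    | add x y hx hy => simp only [map_add, hx, hy]
    | tmul x y =>
      induction x with
      | zero => simp
      | add x y hx hy => simp only [map_add, hx, hy, TensorProduct.add_tmul]
      | tmul x z => simp [TensorProduct.smul_tmul', smul_smul, mul_comm]
  rw [lam_apply, e1, e3, h, ← e2]; rfl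

lemma eq_zero_of_dual (x : C) (h : ∀ φ : C →ₗ[k] k, φ x = 0) : x = 0 :=
  (Module.forall_dual_apply_eq_zero_iff k _).1 h

lemma lam_lam (φ ψ : C →ₗ[k] k) (x : C) : lam φ (lam ψ x) = lam (φ ∘ₗ lam ψ) x := by
  rw [← sub_eq_zero]
  apply eq_zero_of_dual (k := k)
  intro θ
  rw [map_sub, sub_eq_zero, dual_lam, dual_lam, LinearMap.comp_apply, rho_lam]

lemma lam_lam' (φ ψ : C →ₗ[k] k) (x : C) : lam φ (lam ψ x) = lam (ψ ∘ₗ rho φ) x := by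
  rw [lam_lam]
  congr 1
  congr 1
  ext y
  simp [dual_lam]

lemma exists_proj (V : Submodule k C) : ∃ p : C →ₗ[k] V, ∀ v : V, p v = v := by
  obtain ⟨p, hp⟩ := V.subtype.exists_leftInverse_of_injective (by simp)
  exact ⟨p, fun v => LinearMap.congr_fun hp v⟩

lemma IsSubcoalgebra.lam_mem {V : Submodule k C} (hV : IsSubcoalgebra k V) (φ : C →ₗ[k] k)
    {x : C} (hx : x ∈ V) : lam φ x ∈ V := by
  obtain ⟨t, ht⟩ := hV x hx
  rw [lam_apply, ← ht, sliceR_map]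
  exact Subtype.mem _

lemma IsSubcoalgebra.lam_eq_zero {V : Submodule k C} (hV : IsSubcoalgebra k V) (φ : C →ₗ[k] k)
    (hφ : ∀ v ∈ V, φ v = 0) {x : C} (hx : x ∈ V) : lam φ x = 0 := by
  obtain ⟨t, ht⟩ := hV x hx
  rw [lam_apply, ← ht, sliceR_map]
  have : φ ∘ₗ V.subtype = 0 := by ext v; exact hφ v v.2
  rw [this]
  simp [sliceR]

lemma isSubcoalgebra_of_stable {V : Submodule k C} (h1 : ∀ φ : C →ₗ[k] k, ∀ x ∈ V, lam φ x ∈ V)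
    (h2 : ∀ φ : C →ₗ[k] k, ∀ x ∈ V, rho φ x ∈ V) : IsSubcoalgebra k V := by
  intro x hx
  obtain ⟨p, hp⟩ := exists_proj V
  have hp' : ∀ y ∈ V, V.subtype (p y) = y := fun y hy => congrArg Subtype.val (hp ⟨y, hy⟩)
  refine ⟨TensorProduct.map p p (Coalgebra.comul x), ?_⟩
  have e1 : TensorProduct.map (V.subtype ∘ₗ p) LinearMap.id (Coalgebra.comul x)
      = Coalgebra.comul (R := k) x := by
    rw [← sub_eq_zero]
    apply sliceR_separates
    intro φ
    rw [map_sub, sliceR_map, sub_eq_zero]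
    exact hp' _ (h1 φ x hx)
  have e2 : TensorProduct.map LinearMap.id (V.subtype ∘ₗ p) (Coalgebra.comul x)
      = Coalgebra.comul (R := k) x := by
    rw [← sub_eq_zero]
    apply sliceL_separates
    intro φ
    rw [map_sub, sliceL_map, sub_eq_zero]
    exact hp' _ (h2 φ x hx)
  conv_rhs => rw [← e1, ← e2]
  generalize Coalgebra.comul (R := k) x = t
  induction t with
  | zero => simp
  | tmul x y => simp
  | add x y hx hy => simp only [map_add, hx, hy]

lemma coradical_lam_mem (φ : C →ₗ[k] k) {x : C} (hx : x ∈ coradical k C) :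
    lam φ x ∈ coradical k C := by
  have : coradical k C ≤ (coradical k C).comap (lam φ) := by
    conv_lhs => rw [coradical]
    refine sSup_le fun V hV x hx => ?_
    exact (le_sSup hV : V ≤ coradical k C) (hV.2.1.lam_mem φ hx)
  exact this hx

lemma coradical_lam_eq_zero (φ : C →ₗ[k] k) (hφ : ∀ v ∈ coradical k C, φ v = 0)
    {x : C} (hx : x ∈ coradical k C) : lam φ x = 0 := by
  apply eq_zero_of_dual (k := k)
  intro ψ
  have : coradical k C ≤ LinearMap.ker (lam φ) := by
    conv_lhs => rw [coradical]
    refine sSup_le fun V hV x hx => ?_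
    exact hV.2.1.lam_eq_zero φ (fun v hv => hφ v ((le_sSup hV : V ≤ coradical k C) hv)) hx
  rw [this hx, map_zero]

lemma mem_coradicalOne_of {x : C}
    (h : ∀ φ ψ : C →ₗ[k] k, (∀ v ∈ coradical k C, φ v = 0) → (∀ v ∈ coradical k C, ψ v = 0) →
      φ (lam ψ x) = 0) : x ∈ coradicalOne k C := by
  rw [coradicalOne]
  set Z := coradical k C
  obtain ⟨p, hp⟩ := exists_proj Z
  have hp' : ∀ y ∈ Z, Z.subtype (p y) = y := fun y hy => congrArg Subtype.val (hp ⟨y, hy⟩)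
  let P : C →ₗ[k] C := Z.subtype ∘ₗ p
  let Q : C →ₗ[k] C := LinearMap.id - P
  have hQ : ∀ y ∈ Z, Q y = 0 := fun y hy => by simp [Q, P]; rw [sub_eq_zero]; exact (hp' y hy).symm
  have hQQ : TensorProduct.map Q Q (Coalgebra.comul (R := k) x) = 0 := by
    apply slice_separates
    intro φ ψ
    rw [sliceR_map]
    exact h (φ ∘ₗ Q) (ψ ∘ₗ Q) (fun v hv => by simp [hQ v hv]) (fun v hv => by simp [hQ v hv])
  have e : ∀ t : C ⊗[k] C, t = TensorProduct.map LinearMap.id Z.subtype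
        (TensorProduct.map LinearMap.id p t) +
      TensorProduct.map Z.subtype LinearMap.id (TensorProduct.map p Q t) +
      TensorProduct.map Q Q t := by
    intro t
    induction t with
    | zero => simp
    | tmul x y => simp [Q, P, TensorProduct.tmul_sub, TensorProduct.sub_tmul]; abel
    | add x y hx hy =>
      conv_lhs => rw [hx, hy]
      simp only [map_add]; abel
  rw [Submodule.mem_comap, e (Coalgebra.comul x), hQQ, add_zero]
  exact Submodule.add_mem_sup ⟨_, rfl⟩ ⟨_, rfl⟩

lemma coradical_le_coradicalOne : coradical k C ≤ coradicalOne k C := by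
  intro x hx
  apply mem_coradicalOne_of
  intro φ ψ hφ hψ
  rw [coradical_lam_eq_zero ψ hψ hx, map_zero]

/-- Elements killed by all products of `n` functionals vanishing on the coradical. -/
def inF : ℕ → C → Prop
  | 0, x => x = 0
  | n + 1, x => ∀ φ : C →ₗ[k] k, (∀ v ∈ coradical k C, φ v = 0) → inF n (lam φ x)

lemma inF_rho : ∀ (n : ℕ) (x : C) (φ : C →ₗ[k] k), inF (k := k) n x → inF (k := k) n (rho φ x)
  | 0, x, φ, h => by
    have h' : x = 0 := h
    show rho φ x = 0
    rw [h', map_zero]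
  | n + 1, x, φ, h => fun ψ hψ => by
    rw [← rho_lam]
    exact inF_rho n _ φ (h ψ hψ)

lemma inF_rho_lower : ∀ (n : ℕ) (x : C) (φ : C →ₗ[k] k), (∀ v ∈ coradical k C, φ v = 0) →
    inF (k := k) (n + 1) x → inF (k := k) n (rho φ x)
  | 0, x, φ, hφ, h => by
    apply eq_zero_of_dual (k := k)
    intro ψ
    rw [← dual_lam, ← counit_lam, lam_lam]
    have h' : lam (φ ∘ₗ lam ψ) x = 0 := h _ (fun v hv => hφ _ (coradical_lam_mem ψ hv))
    rw [h', map_zero]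
  | n + 1, x, φ, hφ, h => fun ψ hψ => by
    rw [← rho_lam]
    exact inF_rho_lower n _ φ hφ (h ψ hψ)

lemma inF_lam_lower : ∀ (n m : ℕ) (x : C) (χ : C →ₗ[k] k),
    (∀ y, inF (k := k) m y → χ y = 0) → inF (k := k) (m + n) x → inF (k := k) n (lam χ x)
  | 0, m, x, χ, hχ, h => by
    apply eq_zero_of_dual (k := k)
    intro φ
    rw [dual_lam]
    exact hχ _ (inF_rho m x φ h)
  | n + 1, m, x, χ, hχ, h => fun θ hθ => by
    rw [lam_lam']
    refine inF_lam_lower n (m + 1) x _ (fun y hy => hχ _ (inF_rho_lower m y θ hθ hy)) ?_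
    rwa [show m + 1 + n = m + (n + 1) by omega]

lemma inF_two {x : C} (h : inF (k := k) 2 x) : x ∈ coradicalOne k C := by
  apply mem_coradicalOne_of
  intro φ ψ hφ hψ
  rw [← counit_lam, show lam φ (lam ψ x) = 0 from h ψ hψ φ hφ, map_zero]

lemma inF_succ : ∀ (n : ℕ) (x : C), inF (k := k) n x → inF (k := k) (n + 1) x
  | 0, x, h => fun φ hφ => by
    have h' : x = 0 := h
    show lam φ x = 0
    rw [h', map_zero]
  | n + 1, x, h => fun φ hφ => inF_succ n _ (h φ hφ)

section main
variable {D : Type*} [AddCommGroup D] [Module k D] [Coalgebra k D]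

lemma map_lam (f : C →ₗc[k] D) (ψ : D →ₗ[k] k) (x : C) :
    f (lam (ψ ∘ₗ (f : C →ₗ[k] D)) x) = lam ψ (f x) := by
  rw [lam_apply, lam_apply, ← CoalgHomClass.map_comp_comul_apply, sliceR_map]
  rfl

lemma ker_inF (f : C →ₗc[k] D) (hf : Set.InjOn f (coradicalOne k C : Set C)) :
    ∀ (n : ℕ) (x : C), f x = 0 → inF (k := k) (n + 2) x → x = 0
  | 0, x, hx, h => hf (inF_two h) (Submodule.zero_mem _) (by rw [hx, map_zero])
  | n + 1, x, hx, h => by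
    apply ker_inF f hf n x hx
    intro φ hφ
    obtain ⟨g, hg⟩ := ((f : C →ₗ[k] D) ∘ₗ
      (coradicalOne k C).subtype).exists_leftInverse_of_injective (by
        rw [LinearMap.ker_eq_bot]
        intro a b hab
        exact Subtype.ext (hf a.2 b.2 hab))
    let ψ : D →ₗ[k] k := φ ∘ₗ (coradicalOne k C).subtype ∘ₗ g
    have hψ : ∀ y ∈ coradicalOne k C, ψ (f y) = φ y := fun y hy => by
      have := LinearMap.congr_fun hg ⟨y, hy⟩
      have h2 : g (f y) = ⟨y, hy⟩ := this
      simp [ψ, h2]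
    have h0 : lam (ψ ∘ₗ (f : C →ₗ[k] D)) x = 0 := by
      apply ker_inF f hf n
      · rw [map_lam, hx, map_zero]
      · apply h
        intro v hv
        exact (hψ v (coradical_le_coradicalOne hv)).trans (hφ v hv)
    have h1 : lam φ x = lam (φ - ψ ∘ₗ (f : C →ₗ[k] D)) x := by
      have : φ = (φ - ψ ∘ₗ (f : C →ₗ[k] D)) + ψ ∘ₗ (f : C →ₗ[k] D) := by abel
      conv_lhs => rw [this, lam_add, LinearMap.add_apply, h0, add_zero]
    rw [h1]
    refine inF_lam_lower (n + 1) 2 x _ (fun y hy => ?_) ?_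
    · have := hψ y (inF_two hy)
      simp only [LinearMap.sub_apply, LinearMap.comp_apply, sub_eq_zero]
      exact this.symm
    · rwa [show 2 + (n + 1) = n + 1 + 2 by omega]

end main

variable (k C) in
/-- The algebra of all operators `lam φ`. -/
noncomputable def lamAlg : Subalgebra k (Module.End k C) where
  carrier := Set.range lam
  mul_mem' := by
    rintro _ _ ⟨φ, rfl⟩ ⟨ψ, rfl⟩
    exact ⟨φ ∘ₗ lam ψ, by ext x; exact (lam_lam φ ψ x).symm⟩
  add_mem' := by
    rintro _ _ ⟨φ, rfl⟩ ⟨ψ, rfl⟩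
    exact ⟨φ + ψ, lam_add _ _⟩
  algebraMap_mem' := fun c => ⟨c • Coalgebra.counit, by rw [lam_smul, lam_counit]; rfl⟩

/-- `lam φ` as an element of the algebra. -/
noncomputable def lamA (φ : C →ₗ[k] k) : lamAlg k C := ⟨lam φ, φ, rfl⟩

lemma lamA_smul (φ : C →ₗ[k] k) (x : C) : lamA φ • x = lam φ x := rfl

/-- `rho φ` is linear over the algebra. -/
noncomputable def rhoA (φ : C →ₗ[k] k) : C →ₗ[lamAlg k C] C where
  toFun := rho φ
  map_add' := map_add _
  map_smul' := by
    rintro ⟨_, ψ, rfl⟩ x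
    exact rho_lam φ ψ x

lemma rhoA_apply (φ : C →ₗ[k] k) (x : C) : rhoA φ x = rho φ x := rfl

/-- A subspace stable under all `lam φ`. -/
def toA (W : Submodule k C) (h : ∀ φ : C →ₗ[k] k, ∀ x ∈ W, lam φ x ∈ W) :
    Submodule (lamAlg k C) C where
  carrier := W
  add_mem' := W.add_mem
  zero_mem' := W.zero_mem
  smul_mem' := by
    rintro ⟨_, ψ, rfl⟩ x hx
    exact h ψ x hx

lemma exists_simple_le_of_le {R M : Type*} [Ring R] [AddCommGroup M] [Module R M]
    (W T : Submodule R M) [IsSemisimpleModule R T] (h : W ≤ T) (h0 : W ≠ ⊥) :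
    ∃ S ≤ W, IsSimpleModule R S := by
  have := IsSemisimpleModule.of_injective _ (Submodule.inclusion_injective h)
  exact (IsSemisimpleModule.eq_bot_or_exists_simple_le W).resolve_left h0

lemma simple_le_coradical (S : Submodule (lamAlg k C) C) [IsSimpleModule (lamAlg k C) S] :
    ∀ s ∈ S, s ∈ coradical k C := by
  set T := isotypicComponent (lamAlg k C) C S with hT
  have hST : S ≤ T := S.le_isotypicComponent
  have hsub : IsSubcoalgebra k (T.restrictScalars k) := by
    apply isSubcoalgebra_of_stable
    · intro φ x hx
      exact T.smul_mem (lamA φ) hx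
    · intro φ x hx
      exact LinearMap.le_comap_isotypicComponent S (rhoA φ) hx
  have hsimple : IsSimpleSubcoalgebra k (T.restrictScalars k) := by
    refine ⟨?_, hsub, ?_⟩
    · intro h
      have := bot_lt_isotypicComponent S
      rw [← hT] at this
      refine this.ne' ?_
      rwa [Submodule.restrictScalars_eq_bot_iff] at h
    · intro W hW hWT
      by_cases hW0 : W = ⊥
      · exact Or.inl hW0
      refine Or.inr (le_antisymm hWT ?_)
      let WA := toA W (fun φ x hx => hW.lam_mem φ hx)
      have hWA : WA ≤ T := hWT
      have hWA0 : WA ≠ ⊥ := by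
        intro h
        apply hW0
        rw [eq_bot_iff]
        intro x hx
        have : x ∈ WA := hx
        rw [h] at this
        exact this
      have : IsSemisimpleModule (lamAlg k C) T := by rw [hT]; infer_instance
      obtain ⟨S', hS'W, hS'⟩ := exists_simple_le_of_le WA T hWA hWA0
      obtain ⟨e⟩ : Nonempty (S' ≃ₗ[lamAlg k C] S) :=
        isIsotypicOfType_submodule_iff.1
          (IsIsotypicOfType.isotypicComponent (lamAlg k C) C S) S' (hS'W.trans hWA)
      have : T ≤ WA := by
        rw [hT]
        refine sSup_le ?_
        rintro U ⟨u⟩ x hx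
        show x ∈ W
        rw [← Subspace.forall_mem_dualAnnihilator_apply_eq_zero_iff]
        intro φ hφ
        rw [Submodule.mem_dualAnnihilator] at hφ
        let i := u.trans e.symm
        have h1 : lamA φ • i ⟨x, hx⟩ = 0 := by
          apply Subtype.ext
          exact hW.lam_eq_zero φ hφ (hS'W (i ⟨x, hx⟩).2)
        rw [← map_smul, LinearEquiv.map_eq_zero_iff] at h1
        have h2 : lam φ x = 0 := congrArg Subtype.val h1
        rw [← counit_lam, h2, map_zero]
      exact this
  intro s hs
  exact (le_sSup hsimple : T.restrictScalars k ≤ coradical k C) (hST hs)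

lemma finite_inF (d : ℕ) : ∀ (N : Submodule (lamAlg k C) C),
    Module.Finite k (N.restrictScalars k) → Module.finrank k (N.restrictScalars k) ≤ d →
    ∃ n, ∀ x ∈ N, inF (k := k) n x := by
  induction d with
  | zero =>
    intro N hfin hd
    refine ⟨0, fun x hx => ?_⟩
    have := Submodule.finrank_eq_zero.1 (Nat.le_zero.1 hd)
    have hx' : x ∈ N.restrictScalars k := hx
    rw [this] at hx'
    exact hx'
  | succ d ih =>
    intro N hfin hd
    by_cases hN : N = ⊥
    · refine ⟨0, fun x hx => ?_⟩
      rw [hN] at hx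
      exact hx
    have : Nontrivial N := (Submodule.nontrivial_iff_ne_bot).2 hN
    have : Module.Finite k N := hfin
    have : IsNoetherian (lamAlg k C) N :=
      @isNoetherian_of_tower k (lamAlg k C) N _ _ _ _ _ (N.restrictScalars k).module
        ⟨fun c a n => Subtype.ext (smul_assoc c a (n : C))⟩
        (inferInstance : IsNoetherian k (N.restrictScalars k))
    obtain ⟨M, hM⟩ := IsCoatomic.exists_coatom (Submodule (lamAlg k C) N)
    have hcov : M.map N.subtype ⋖ N :=
      Set.Iic.isCoatom_iff.1 ((OrderIso.isCoatom_iff (Submodule.mapIic N) M).2 hM)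
    set N' := M.map N.subtype with hN'
    have hlt : N'.restrictScalars k < N.restrictScalars k := hcov.lt
    have : Module.Finite k (N'.restrictScalars k) :=
      Submodule.finiteDimensional_of_le hlt.le
    obtain ⟨m, hm⟩ := ih N' inferInstance (by
      have := Submodule.finrank_lt_finrank_of_lt hlt
      omega)
    obtain ⟨x0, hx0, hx0'⟩ := SetLike.exists_of_lt hcov.lt
    obtain ⟨ψ, hψ0, hψ⟩ : ∃ ψ : C →ₗ[k] k, ψ x0 ≠ 0 ∧ ∀ y ∈ N', ψ y = 0 := by
      have := (Subspace.forall_mem_dualAnnihilator_apply_eq_zero_iff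
        (N'.restrictScalars k) x0).not.2 hx0'
      push Not at this
      obtain ⟨ψ, h1, h2⟩ := this
      exact ⟨ψ, h2, (Submodule.mem_dualAnnihilator ψ).1 h1⟩
    have hker : ∀ y ∈ N', rhoA ψ y = 0 := by
      intro y hy
      apply eq_zero_of_dual (k := k)
      intro φ
      rw [rhoA_apply, ← dual_lam]
      exact hψ _ (N'.smul_mem (lamA φ) hy)
    have hx0r : rhoA ψ x0 ≠ 0 := by
      intro h
      apply hψ0
      rw [← counit_rho, ← rhoA_apply, h, map_zero]
    let S := N.map (rhoA ψ)
    have hS : IsAtom S := by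
      refine ⟨fun h => hx0r ?_, fun W hW => ?_⟩
      · have : rhoA ψ x0 ∈ S := Submodule.mem_map_of_mem hx0
        rw [h] at this
        exact this
      · have hle : N' ≤ W.comap (rhoA ψ) ⊓ N := fun y hy =>
          ⟨by
            show rhoA ψ y ∈ W
            rw [hker y hy]; exact W.zero_mem, hcov.le hy⟩
        rcases hcov.eq_or_eq hle inf_le_right with h | h
        · rw [eq_bot_iff]
          intro w hw
          obtain ⟨n, hn, rfl⟩ := hW.le hw
          have : n ∈ W.comap (rhoA ψ) ⊓ N := ⟨hw, hn⟩
          rw [h] at this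
          exact hker n this
        · exfalso
          refine hW.not_ge ?_
          rintro _ ⟨n, hn, rfl⟩
          have hn' : n ∈ N := hn
          rw [← h] at hn'
          exact hn'.1
    have : IsSimpleModule (lamAlg k C) S := isSimpleModule_iff_isAtom.2 hS
    have hS0 := simple_le_coradical S
    refine ⟨m + 1, fun x hx φ hφ => hm _ ?_⟩
    have hle : N' ≤ LinearMap.ker (rhoA ψ) ⊓ N := fun y hy => ⟨hker y hy, hcov.le hy⟩
    have heq : LinearMap.ker (rhoA ψ) ⊓ N = N' := by
      rcases hcov.eq_or_eq hle inf_le_right with h | h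
      · exact h
      · exfalso
        have hn' : x0 ∈ N := hx0
        rw [← h] at hn'
        exact hx0r hn'.1
    rw [← heq]
    refine ⟨?_, N.smul_mem (lamA φ) hx⟩
    show rho ψ (lam φ x) = 0
    rw [rho_lam]
    exact coradical_lam_eq_zero φ hφ (hS0 _ (Submodule.mem_map_of_mem hx))

lemma exists_inF (x : C) : ∃ n, inF (k := k) n x := by
  let L : (C →ₗ[k] k) →ₗ[k] C :=
    { toFun := fun φ => lam φ x
      map_add' := fun φ ψ => by rw [lam_add]; rfl
      map_smul' := fun c ψ => by rw [lam_smul]; rfl }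
  let N := toA (LinearMap.range L) (by
    rintro φ _ ⟨ψ, rfl⟩
    exact ⟨φ ∘ₗ lam ψ, (lam_lam φ ψ x).symm⟩)
  have hfin : Module.Finite k (N.restrictScalars k) := by
    show Module.Finite k (LinearMap.range L)
    have key : ∀ t : C ⊗[k] C, ∃ V : Submodule k C, Module.Finite k V ∧
        ∀ φ : C →ₗ[k] k, sliceR φ t ∈ V := by
      intro t
      induction t with
      | zero => exact ⟨⊥, inferInstance, fun φ => by simp⟩
      | tmul a b =>
        exact ⟨k ∙ a, inferInstance, fun φ => by
          rw [sliceR_tmul]; exact Submodule.smul_mem _ _ (Submodule.mem_span_singleton_self a)⟩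
      | add s t hs ht =>
        obtain ⟨V, hV, h1⟩ := hs
        obtain ⟨W, hW, h2⟩ := ht
        exact ⟨V ⊔ W, inferInstance, fun φ => by
          rw [map_add]; exact Submodule.add_mem_sup (h1 φ) (h2 φ)⟩
    obtain ⟨V, hV, h⟩ := key (Coalgebra.comul x)
    refine Submodule.finiteDimensional_of_le (S₂ := V) ?_
    rintro _ ⟨φ, rfl⟩
    exact h φ
  obtain ⟨n, hn⟩ := finite_inF _ N hfin le_rfl
  exact ⟨n, hn x ⟨Coalgebra.counit, by show lam _ x = x; rw [lam_counit]; rfl⟩⟩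

end Helpers

theorem coalgHom_injective_iff_injOn_coradicalOne
    (C D : Type*) [AddCommGroup C] [Module k C] [Coalgebra k C]
    [AddCommGroup D] [Module k D] [Coalgebra k D]
    (hC : IsPointedCoalgebra k C) (f : C →ₗc[k] D) :
    Function.Injective f ↔ Set.InjOn f (coradicalOne k C : Set C) := by
  refine ⟨fun h => h.injOn, fun h => ?_⟩
  rw [injective_iff_map_eq_zero]
  intro x hx
  obtain ⟨n, hn⟩ := exists_inF (k := k) x
  exact ker_inF f h n x hx (inF_succ _ _ (inF_succ _ _ hn))
end
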